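/- Let A be an arbitrary 2-index real array on n-dimensional Minkowski vector space with superenergy tensor T, and let ℓ be a null vector. Then T_{αβλμ}ℓ^αℓ^λ = 0 for all β,μ if and only if ℓ_ρA_{μν}ℓ_τ − ℓ_μA_{ρν}ℓ_τ − ℓ_ρA_{μτ}ℓ_ν + ℓ_μA_{ρτ}ℓ_ν = 0 for all ρ,μ,ν,τ (i.e. ℓ_{[ρ}A_{μ][ν}ℓ_{τ]} = 0). -/

import Mathlib

open Finset

noncomputable section

/-- Sign of the `i`-th diagonal entry of the Minkowski metric diag(-1,1,...,1). -/
def sgn {n : ℕ} (i : Fin n) : ℝ := if (i : ℕ) = 0 then -1 else 1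

/-- The Minkowski metric components η_{ij} (= η^{ij}). -/
def eta {n : ℕ} (i j : Fin n) : ℝ := if i = j then sgn i else 0

/-- Minkowski square η(v,v) of a vector. -/
def mSq {n : ℕ} (v : Fin n → ℝ) : ℝ := ∑ i, sgn i * v i * v i

/-- Lowered components v_i = η_{ij} v^j. -/
def lo {n : ℕ} (v : Fin n → ℝ) (i : Fin n) : ℝ := sgn i * v i

/-- The superenergy tensor of an arbitrary 2-index array A (no symmetries assumed). -/
def SE2 {n : ℕ} (A : Fin n → Fin n → ℝ) (a b l m : Fin n) : ℝ :=
  A a l * A b m + A b l * A a m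
  - eta a b * (∑ r, sgn r * A r l * A r m)
  - eta l m * (∑ r, sgn r * A a r * A b r)
  + (1/2) * eta a b * eta l m * (∑ r, ∑ s, sgn r * sgn s * A r s * A r s)

/-- The contraction `A_{bλ} ℓ^λ` of an array with a vector in its second slot. -/
def contrR {n : ℕ} (A : Fin n → Fin n → ℝ) (ℓ : Fin n → ℝ) (b : Fin n) : ℝ := ∑ l, A b l * ℓ l

/-- The contraction `ℓ^α A_{αm}` of an array with a vector in its first slot. -/
def contrL {n : ℕ} (A : Fin n → Fin n → ℝ) (ℓ : Fin n → ℝ) (m : Fin n) : ℝ := ∑ a, A a m * ℓ a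

/-- The full contraction `A_{ρσ} A^{ρσ}`. -/
def arrSq {n : ℕ} (A : Fin n → Fin n → ℝ) : ℝ := ∑ r, ∑ s, sgn r * sgn s * A r s * A r s

lemma sgn_mul_self {n : ℕ} (i : Fin n) : sgn i * sgn i = 1 := by
  unfold sgn; split_ifs <;> norm_num

lemma sgn_mul_lo {n : ℕ} (v : Fin n → ℝ) (i : Fin n) : sgn i * lo v i = v i := by
  rw [lo, ← mul_assoc, sgn_mul_self, one_mul]

lemma sum_lo_mul_self {n : ℕ} (v : Fin n → ℝ) : ∑ i, lo v i * v i = mSq v := rfl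

lemma sum_eta_mul {n : ℕ} (v : Fin n → ℝ) (b : Fin n) : ∑ a, eta a b * v a = lo v b := by
  simp [eta, lo, ite_mul]

lemma sum_SE2_right {n : ℕ} (A : Fin n → Fin n → ℝ) (ℓ : Fin n → ℝ) (a b m : Fin n) :
    ∑ l, SE2 A a b l m * ℓ l =
      contrR A ℓ a * A b m + contrR A ℓ b * A a m
        - eta a b * (∑ r, sgn r * contrR A ℓ r * A r m)
        - lo ℓ m * (∑ r, sgn r * A a r * A b r)
        + 1 / 2 * eta a b * lo ℓ m * arrSq A := by
  have h : ∑ l, (∑ r, sgn r * A r l * A r m) * ℓ l = ∑ r, sgn r * contrR A ℓ r * A r m := by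
    simp only [contrR, sum_mul, mul_sum]
    rw [sum_comm]
    exact sum_congr rfl fun r _ => sum_congr rfl fun l _ => by ring
  rw [← h, ← sum_eta_mul ℓ m]
  simp only [contrR, sum_mul, mul_sum (s := univ) (a := eta a b),
    mul_sum (s := univ) (a := 1 / 2 * eta a b), ← sum_add_distrib, ← sum_sub_distrib]
  refine sum_congr rfl fun l _ => ?_
  simp only [SE2, ← mul_sum, ← sum_mul, arrSq]
  ring

lemma sum_SE2 {n : ℕ} (A : Fin n → Fin n → ℝ) (ℓ : Fin n → ℝ) (b m : Fin n) :
    ∑ a, ∑ l, SE2 A a b l m * ℓ a * ℓ l =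
      (∑ a, contrR A ℓ a * ℓ a) * A b m + contrR A ℓ b * contrL A ℓ m
        - lo ℓ b * (∑ r, sgn r * contrR A ℓ r * A r m)
        - lo ℓ m * (∑ r, sgn r * contrL A ℓ r * A b r)
        + 1 / 2 * lo ℓ b * lo ℓ m * arrSq A := by
  have h : ∑ a, (∑ r, sgn r * A a r * A b r) * ℓ a = ∑ r, sgn r * contrL A ℓ r * A b r := by
    simp only [contrL, sum_mul, mul_sum]
    rw [sum_comm]
    exact sum_congr rfl fun r _ => sum_congr rfl fun l _ => by ring
  have h1 : ∀ a, ∑ l, SE2 A a b l m * ℓ a * ℓ l = (∑ l, SE2 A a b l m * ℓ l) * ℓ a := by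
    intro a
    rw [sum_mul]
    exact sum_congr rfl fun l _ => by ring
  simp only [h1, sum_SE2_right]
  have h2 : contrL A ℓ m = ∑ a, A a m * ℓ a := rfl
  rw [← h, ← sum_eta_mul ℓ b, h2]
  generalize (∑ r, sgn r * contrR A ℓ r * A r m) = X
  have : ∀ a, (contrR A ℓ a * A b m + contrR A ℓ b * A a m - eta a b * X
        - lo ℓ m * (∑ r, sgn r * A a r * A b r) + 1 / 2 * eta a b * lo ℓ m * arrSq A) * ℓ a
      = A b m * (contrR A ℓ a * ℓ a) + contrR A ℓ b * (A a m * ℓ a) - X * (eta a b * ℓ a)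
        - lo ℓ m * ((∑ r, sgn r * A a r * A b r) * ℓ a)
        + 1 / 2 * lo ℓ m * arrSq A * (eta a b * ℓ a) := fun a => by ring
  simp only [this, sum_add_distrib, sum_sub_distrib, ← mul_sum]
  ring

lemma sum_contrL_mul {n : ℕ} (A : Fin n → Fin n → ℝ) (ℓ : Fin n → ℝ) :
    ∑ m, contrL A ℓ m * ℓ m = ∑ a, contrR A ℓ a * ℓ a := by
  simp only [contrL, contrR, sum_mul]
  rw [sum_comm]
  exact sum_congr rfl fun r _ => sum_congr rfl fun l _ => by ring

/-- A covector whose time component vanishes and which has zero Minkowski square is zero. -/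
lemma eq_zero_of_sum_sgn_sq {n : ℕ} {z : Fin n → ℝ} {o : Fin n} (ho : (o : ℕ) = 0)
    (hz : z o = 0) (h : ∑ i, sgn i * z i * z i = 0) (i : Fin n) : z i = 0 := by
  have hsq : ∀ i, sgn i * z i * z i = z i * z i := by
    intro i
    by_cases hi : (i : ℕ) = 0
    · rw [show i = o from Fin.ext (hi.trans ho.symm), hz]; simp
    · simp [sgn, hi]
  simp only [hsq] at h
  exact mul_self_eq_zero.mp
    ((sum_eq_zero_iff_of_nonneg fun i _ => mul_self_nonneg (z i)).mp h i (mem_univ i))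

/-- An array whose components with a time index vanish and which has zero square is zero. -/
lemma eq_zero_of_arrSq {n : ℕ} {D : Fin n → Fin n → ℝ} {o : Fin n} (ho : (o : ℕ) = 0)
    (hl : ∀ v, D o v = 0) (hr : ∀ m, D m o = 0) (h : arrSq D = 0) (m v : Fin n) :
    D m v = 0 := by
  have hsq : ∀ r s, sgn r * sgn s * D r s * D r s = D r s * D r s := by
    intro r s
    by_cases hr0 : (r : ℕ) = 0
    · rw [show r = o from Fin.ext (hr0.trans ho.symm), hl]; simp
    by_cases hs0 : (s : ℕ) = 0
    · rw [show s = o from Fin.ext (hs0.trans ho.symm), hr]; simp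
    simp [sgn, hr0, hs0]
  simp only [arrSq, hsq] at h
  have h1 := (sum_eq_zero_iff_of_nonneg
    fun r _ => sum_nonneg fun s _ => mul_self_nonneg (D r s)).mp h m (mem_univ m)
  exact mul_self_eq_zero.mp
    ((sum_eq_zero_iff_of_nonneg fun s _ => mul_self_nonneg (D m s)).mp h1 v (mem_univ v))

lemma lo_time_ne_zero {n : ℕ} {ℓ : Fin n → ℝ} (hℓ0 : ℓ ≠ 0) (hnull : mSq ℓ = 0) {o : Fin n}
    (ho : (o : ℕ) = 0) : lo ℓ o ≠ 0 := by
  intro h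
  have ho_zero : ℓ o = 0 := by rw [← sgn_mul_lo ℓ, h, mul_zero]
  exact hℓ0 (funext (eq_zero_of_sum_sgn_sq ho ho_zero hnull))

/-- A null covector orthogonal to a null vector is proportional to it. -/
lemma exists_eq_mul_lo {n : ℕ} {ℓ : Fin n → ℝ} (hℓ0 : ℓ ≠ 0) (hnull : mSq ℓ = 0) {o : Fin n}
    (ho : (o : ℕ) = 0) {w : Fin n → ℝ} (hw : ∑ i, sgn i * w i * w i = 0)
    (hwl : ∑ i, w i * ℓ i = 0) : ∃ q, ∀ i, w i = q * lo ℓ i := by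
  have hL := lo_time_ne_zero hℓ0 hnull ho
  refine ⟨w o / lo ℓ o, fun i => ?_⟩
  have h0 : w o - w o / lo ℓ o * lo ℓ o = 0 := by field_simp; ring
  refine sub_eq_zero.mp
    (eq_zero_of_sum_sgn_sq (z := fun i => w i - w o / lo ℓ o * lo ℓ i) ho h0 ?_ i)
  generalize w o / lo ℓ o = q
  have : ∀ i, sgn i * (w i - q * lo ℓ i) * (w i - q * lo ℓ i)
      = sgn i * w i * w i - 2 * q * (w i * ℓ i) + q ^ 2 * (lo ℓ i * ℓ i) := fun i => by
    rw [← sgn_mul_lo ℓ i]; ring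
  simp only [this, sum_add_distrib, sum_sub_distrib, ← mul_sum, hw, hwl, sum_lo_mul_self, hnull]
  ring

lemma contrR_add_lo {n : ℕ} {ℓ : Fin n → ℝ} (hnull : mSq ℓ = 0) (A : Fin n → Fin n → ℝ)
    (p q : Fin n → ℝ) (b : Fin n) :
    contrR (fun i j => A i j + lo ℓ i * p j + q i * lo ℓ j) ℓ b
      = contrR A ℓ b + lo ℓ b * ∑ i, p i * ℓ i := by
  simp only [contrR, add_mul, sum_add_distrib, mul_assoc, ← mul_sum, sum_lo_mul_self, hnull]
  ring

lemma contrL_add_lo {n : ℕ} {ℓ : Fin n → ℝ} (hnull : mSq ℓ = 0) (A : Fin n → Fin n → ℝ)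
    (p q : Fin n → ℝ) (m : Fin n) :
    contrL (fun i j => A i j + lo ℓ i * p j + q i * lo ℓ j) ℓ m
      = contrL A ℓ m + lo ℓ m * ∑ i, q i * ℓ i := by
  have : ∀ a, (A a m + lo ℓ a * p m + q a * lo ℓ m) * ℓ a
      = A a m * ℓ a + p m * (lo ℓ a * ℓ a) + lo ℓ m * (q a * ℓ a) := fun a => by ring
  simp only [contrL, this, sum_add_distrib, ← mul_sum, sum_lo_mul_self, hnull]
  ring

lemma arrSq_add_lo {n : ℕ} {ℓ : Fin n → ℝ} (hnull : mSq ℓ = 0) (A : Fin n → Fin n → ℝ)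
    (p q : Fin n → ℝ) :
    arrSq (fun i j => A i j + lo ℓ i * p j + q i * lo ℓ j)
      = arrSq A + 2 * (∑ s, sgn s * contrL A ℓ s * p s) + 2 * (∑ r, sgn r * contrR A ℓ r * q r)
        + 2 * (∑ i, p i * ℓ i) * (∑ i, q i * ℓ i) := by
  have h1 : ∑ s, sgn s * contrL A ℓ s * p s = ∑ r, ∑ s, sgn s * A r s * ℓ r * p s := by
    rw [sum_comm]
    simp only [contrL, mul_sum, sum_mul]
    exact sum_congr rfl fun r _ => sum_congr rfl fun l _ => by ring
  have h2 : ∑ r, sgn r * contrR A ℓ r * q r = ∑ r, ∑ s, sgn r * A r s * ℓ s * q r := by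
    simp only [contrR, mul_sum, sum_mul]
    exact sum_congr rfl fun r _ => sum_congr rfl fun l _ => by ring
  have key : ∀ r s, sgn r * sgn s * (A r s + lo ℓ r * p s + q r * lo ℓ s)
        * (A r s + lo ℓ r * p s + q r * lo ℓ s)
      = sgn r * sgn s * A r s * A r s + 2 * (sgn s * A r s * ℓ r * p s)
        + 2 * (sgn r * A r s * ℓ s * q r) + 2 * (q r * ℓ r) * (p s * ℓ s)
        + (lo ℓ r * ℓ r) * (sgn s * p s * p s) + (sgn r * q r * q r) * (lo ℓ s * ℓ s) := by
    intro r s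
    rw [← sgn_mul_lo ℓ r, ← sgn_mul_lo ℓ s]
    ring
  simp only [arrSq, key, h1, h2, sum_add_distrib, ← mul_sum, ← sum_mul, sum_lo_mul_self, hnull]
  ring

lemma sum_SE2_of_contr {n : ℕ} {A : Fin n → Fin n → ℝ} {ℓ : Fin n → ℝ}
    (hnull : mSq ℓ = 0) {P Q : ℝ} (hu : ∀ b, contrR A ℓ b = P * lo ℓ b)
    (hw : ∀ m, contrL A ℓ m = Q * lo ℓ m) (b m : Fin n) :
    ∑ a, ∑ l, SE2 A a b l m * ℓ a * ℓ l
      = lo ℓ b * lo ℓ m * (1 / 2 * arrSq A - P * Q) := by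
  have hc : ∑ a, contrR A ℓ a * ℓ a = 0 := by
    simp only [hu, mul_assoc, ← mul_sum, sum_lo_mul_self, hnull, mul_zero]
  have h1 : ∑ r, sgn r * contrR A ℓ r * A r m = P * (Q * lo ℓ m) := by
    rw [← hw, contrL, mul_sum]
    exact sum_congr rfl fun r _ => by rw [hu, ← sgn_mul_lo ℓ r]; ring
  have h2 : ∑ r, sgn r * contrL A ℓ r * A b r = Q * (P * lo ℓ b) := by
    rw [← hu, contrR, mul_sum]
    exact sum_congr rfl fun r _ => by rw [hw, ← sgn_mul_lo ℓ r]; ring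
  rw [sum_SE2, hc, h1, h2, hu, hw]
  ring

/-- The contracted superenergy tensor vanishes only if both contractions of `A` with the null
vector are proportional to it. -/
lemma exists_contr_eq_of_sum_SE2_eq_zero {n : ℕ} {A : Fin n → Fin n → ℝ} {ℓ : Fin n → ℝ}
    (hℓ0 : ℓ ≠ 0) (hnull : mSq ℓ = 0) {o : Fin n} (ho : (o : ℕ) = 0)
    (h : ∀ b m : Fin n, ∑ a, ∑ l, SE2 A a b l m * ℓ a * ℓ l = 0) :
    (∃ P, ∀ b, contrR A ℓ b = P * lo ℓ b) ∧ ∃ Q, ∀ m, contrL A ℓ m = Q * lo ℓ m := by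
  simp only [sum_SE2] at h
  have hL := lo_time_ne_zero hℓ0 hnull ho
  have hcl := sum_contrL_mul A ℓ
  set c := ∑ a, contrR A ℓ a * ℓ a with hc
  have hwm : ∀ m, 2 * c * contrL A ℓ m
      = lo ℓ m * ∑ r, sgn r * contrL A ℓ r * contrL A ℓ r := by
    intro m
    have e : ∑ r, sgn r * contrL A ℓ r * contrL A ℓ r
        = ∑ b, (∑ r, sgn r * contrL A ℓ r * A b r) * ℓ b := by
      conv_lhs => enter [2, r, 2]; rw [contrL]
      simp only [mul_sum, sum_mul]
      rw [sum_comm]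
      exact sum_congr rfl fun r _ => sum_congr rfl fun l _ => by ring
    have hs : ∑ b, (c * A b m + contrR A ℓ b * contrL A ℓ m
        - lo ℓ b * (∑ r, sgn r * contrR A ℓ r * A r m)
        - lo ℓ m * (∑ r, sgn r * contrL A ℓ r * A b r)
        + 1 / 2 * lo ℓ b * lo ℓ m * arrSq A) * ℓ b = 0 :=
      sum_eq_zero fun b _ => by rw [h, zero_mul]
    generalize (∑ r, sgn r * contrR A ℓ r * A r m) = X at hs
    have hr : ∀ b, (c * A b m + contrR A ℓ b * contrL A ℓ m - lo ℓ b * X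
        - lo ℓ m * (∑ r, sgn r * contrL A ℓ r * A b r)
        + 1 / 2 * lo ℓ b * lo ℓ m * arrSq A) * ℓ b
      = c * (A b m * ℓ b) + contrL A ℓ m * (contrR A ℓ b * ℓ b) - X * (lo ℓ b * ℓ b)
        - lo ℓ m * ((∑ r, sgn r * contrL A ℓ r * A b r) * ℓ b)
        + 1 / 2 * lo ℓ m * arrSq A * (lo ℓ b * ℓ b) := fun b => by ring
    simp only [hr, sum_add_distrib, sum_sub_distrib, ← mul_sum, sum_lo_mul_self, hnull, ← e,
      ← hc] at hs
    rw [← contrL] at hs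
    linarith
  have hum : ∀ b, 2 * c * contrR A ℓ b
      = lo ℓ b * ∑ r, sgn r * contrR A ℓ r * contrR A ℓ r := by
    intro b
    have e : ∑ r, sgn r * contrR A ℓ r * contrR A ℓ r
        = ∑ m, (∑ r, sgn r * contrR A ℓ r * A r m) * ℓ m := by
      conv_lhs => enter [2, r, 2]; rw [contrR]
      simp only [mul_sum, sum_mul]
      rw [sum_comm]
      exact sum_congr rfl fun r _ => sum_congr rfl fun l _ => by ring
    have hs : ∑ m, (c * A b m + contrR A ℓ b * contrL A ℓ m
        - lo ℓ b * (∑ r, sgn r * contrR A ℓ r * A r m)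
        - lo ℓ m * (∑ r, sgn r * contrL A ℓ r * A b r)
        + 1 / 2 * lo ℓ b * lo ℓ m * arrSq A) * ℓ m = 0 :=
      sum_eq_zero fun m _ => by rw [h, zero_mul]
    generalize (∑ r, sgn r * contrL A ℓ r * A b r) = X at hs
    have hr : ∀ m, (c * A b m + contrR A ℓ b * contrL A ℓ m
        - lo ℓ b * (∑ r, sgn r * contrR A ℓ r * A r m) - lo ℓ m * X
        + 1 / 2 * lo ℓ b * lo ℓ m * arrSq A) * ℓ m
      = c * (A b m * ℓ m) + contrR A ℓ b * (contrL A ℓ m * ℓ m)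
        - lo ℓ b * ((∑ r, sgn r * contrR A ℓ r * A r m) * ℓ m) - X * (lo ℓ m * ℓ m)
        + 1 / 2 * lo ℓ b * arrSq A * (lo ℓ m * ℓ m) := fun m => by ring
    simp only [hr, sum_add_distrib, sum_sub_distrib, ← mul_sum, sum_lo_mul_self, hnull, ← e,
      hcl] at hs
    rw [← contrR] at hs
    linarith
  have hc0 : c = 0 := by
    have hs : ∑ b, 2 * c * (contrR A ℓ b * ℓ b)
        = ∑ b, (∑ r, sgn r * contrR A ℓ r * contrR A ℓ r) * (lo ℓ b * ℓ b) :=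
      sum_congr rfl fun b _ => by rw [← mul_assoc, hum]; ring
    rw [← mul_sum, ← mul_sum, sum_lo_mul_self, hnull, ← hc] at hs
    nlinarith
  refine ⟨exists_eq_mul_lo hℓ0 hnull ho ?_ hc0,
    exists_eq_mul_lo hℓ0 hnull ho ?_ (hcl.trans hc0)⟩
  · have := hum o
    rw [hc0, mul_zero, zero_mul] at this
    exact (mul_eq_zero.mp this.symm).resolve_left hL
  · have := hwm o
    rw [hc0, mul_zero, zero_mul] at this
    exact (mul_eq_zero.mp this.symm).resolve_left hL

/-- T_{αβλμ}ℓ^αℓ^λ = 0 iff ℓ_{[ρ}A_{μ][ν}ℓ_{τ]} = 0, for null ℓ. -/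
theorem stmt_17 {n : ℕ} (hn : 2 ≤ n) (A : Fin n → Fin n → ℝ)
    (ℓ : Fin n → ℝ) (hℓ0 : ℓ ≠ 0) (hnull : mSq ℓ = 0) :
    (∀ b m : Fin n, ∑ a, ∑ l, SE2 A a b l m * ℓ a * ℓ l = 0) ↔
      (∀ r m v t : Fin n,
        lo ℓ r * A m v * lo ℓ t - lo ℓ m * A r v * lo ℓ t
        - lo ℓ r * A m t * lo ℓ v + lo ℓ m * A r t * lo ℓ v = 0) := by
  obtain ⟨o, ho⟩ : ∃ o : Fin n, (o : ℕ) = 0 := ⟨⟨0, by omega⟩, rfl⟩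
  have hL := lo_time_ne_zero hℓ0 hnull ho
  constructor
  · intro h
    obtain ⟨⟨P, hP⟩, Q, hQ⟩ := exists_contr_eq_of_sum_SE2_eq_zero hℓ0 hnull ho h
    have hS : 1 / 2 * arrSq A - P * Q = 0 := by
      have := h o o
      rw [sum_SE2_of_contr hnull hP hQ] at this
      exact (mul_eq_zero.mp this).resolve_left (mul_ne_zero hL hL)
    obtain ⟨p, hp⟩ : ∃ p : Fin n → ℝ, ∀ v, p v = -(A o v / lo ℓ o) := ⟨_, fun _ => rfl⟩
    obtain ⟨q, hq⟩ : ∃ q : Fin n → ℝ,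
        ∀ m, q m = -(A m o / lo ℓ o) + lo ℓ m * A o o / lo ℓ o ^ 2 := ⟨_, fun _ => rfl⟩
    have hDl : ∀ v, A o v + lo ℓ o * p v + q o * lo ℓ v = 0 := fun v => by
      rw [hp, hq]; field_simp; ring
    have hDr : ∀ m, A m o + lo ℓ m * p o + q m * lo ℓ o = 0 := fun m => by
      rw [hp, hq]; field_simp; ring
    have hx : P + ∑ i, p i * ℓ i = 0 := by
      have := contrR_add_lo hnull A p q o
      rw [hP, contrR] at this
      simp only [hDl, zero_mul, sum_const_zero] at this
      refine (mul_eq_zero.mp (?_ : lo ℓ o * _ = 0)).resolve_left hL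
      linarith
    have hy : Q + ∑ i, q i * ℓ i = 0 := by
      have := contrL_add_lo hnull A p q o
      rw [hQ, contrL] at this
      simp only [hDr, zero_mul, sum_const_zero] at this
      refine (mul_eq_zero.mp (?_ : lo ℓ o * _ = 0)).resolve_left hL
      linarith
    have hsq : arrSq (fun i j => A i j + lo ℓ i * p j + q i * lo ℓ j) = 0 := by
      have h1 : ∑ s, sgn s * contrL A ℓ s * p s = Q * ∑ i, p i * ℓ i := by
        rw [mul_sum]
        exact sum_congr rfl fun i _ => by rw [hQ, ← sgn_mul_lo ℓ i]; ring
      have h2 : ∑ s, sgn s * contrR A ℓ s * q s = P * ∑ i, q i * ℓ i := by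
        rw [mul_sum]
        exact sum_congr rfl fun i _ => by rw [hP, ← sgn_mul_lo ℓ i]; ring
      rw [arrSq_add_lo hnull, h1, h2, eq_neg_of_add_eq_zero_right hx,
        eq_neg_of_add_eq_zero_right hy]
      linarith
    have hA : ∀ m v, A m v = -(lo ℓ m * p v) - q m * lo ℓ v := fun m v => by
      have := eq_zero_of_arrSq ho hDl hDr hsq m v
      linarith
    intro r m v t
    simp only [hA]
    ring
  · intro h
    obtain ⟨p, hp⟩ : ∃ p : Fin n → ℝ, ∀ v, p v = A o v / lo ℓ o := ⟨_, fun _ => rfl⟩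
    obtain ⟨q, hq⟩ : ∃ q : Fin n → ℝ,
        ∀ m, q m = A m o / lo ℓ o - lo ℓ m * A o o / lo ℓ o ^ 2 := ⟨_, fun _ => rfl⟩
    have hA : A = fun i j => 0 + lo ℓ i * p j + q i * lo ℓ j := by
      funext m v
      have := h o m v o
      rw [hp, hq]
      field_simp
      linarith
    have hu : ∀ b, contrR A ℓ b = (∑ i, p i * ℓ i) * lo ℓ b := fun b => by
      rw [hA, contrR_add_lo hnull (fun _ _ => 0) p q]
      simp [contrR, mul_comm]
    have hw : ∀ m, contrL A ℓ m = (∑ i, q i * ℓ i) * lo ℓ m := fun m => by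
      rw [hA, contrL_add_lo hnull (fun _ _ => 0) p q]
      simp [contrL, mul_comm]
    have hS : arrSq A = 2 * (∑ i, p i * ℓ i) * (∑ i, q i * ℓ i) := by
      rw [hA, arrSq_add_lo hnull (fun _ _ => 0) p q]
      simp [contrL, contrR, arrSq]
    intro b m
    rw [sum_SE2_of_contr hnull hu hw, hS]
    ring
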